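/- Under the NAS splitting ℛ = 𝒯 + 𝒟 with 𝒯 = [[I,T],[-T,I]] (T symmetric positive definite) and 𝒟 = [[0,-D],[D,0]] (D diagonal), for any ω>0 the spectral radius of the iteration matrix ℒ_ω = [(1/(2ω))(ωI+𝒯)(ωI+𝒟)]^{-1}[(1/(2ω))(ωI-𝒯)(ωI-𝒟)] is bounded above by σ(ω) = max_{λ ∈ spec(T)} sqrt(((ω-1)²+λ²)/((ω+1)²+λ²)) < 1; hence the NASS iteration converges unconditionally. -/

import Mathlib

open Matrix

/-- squared Euclidean norm of the image of a complex vector under a real matrix -/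
lemma aux_norm {n : Type*} [Fintype n] [DecidableEq n] (A : Matrix n n ℝ) (v : n → ℂ) :
    star ((A.map (algebraMap ℝ ℂ)) *ᵥ v) ⬝ᵥ ((A.map (algebraMap ℝ ℂ)) *ᵥ v)
      = star v ⬝ᵥ (((Aᵀ * A).map (algebraMap ℝ ℂ)) *ᵥ v) := by
  have h : (A.map (algebraMap ℝ ℂ))ᴴ = (Aᵀ).map (algebraMap ℝ ℂ) := by
    ext i j
    simp [Matrix.conjTranspose_apply]
  rw [star_mulVec, h, Matrix.map_mul, ← mulVec_mulVec, dotProduct_mulVec, dotProduct_mulVec,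
    dotProduct_mulVec]

lemma aux_re {n : Type*} [Fintype n] (v : n → ℂ) :
    (star v ⬝ᵥ v).re = ∑ i, Complex.normSq (v i) := by
  simp [dotProduct, Complex.normSq_apply]

lemma aux_main {n : Type*} [Fintype n] [DecidableEq n] (A B E F C : Matrix n n ℝ) (s : ℝ)
    (hs : 0 ≤ s) (hA : IsUnit A) (hE : IsUnit E) (hAB : A * B = B * A) (hEF : Eᵀ * E = Fᵀ * F)
    (hC : s ^ 2 • (Aᵀ * A) = Bᵀ * B + Cᵀ * C) (c : ℝ) (hc : c ≠ 0) :
    spectralRadius ℂ (((c • (A * E))⁻¹ * (c • (B * F))).map (algebraMap ℝ ℂ))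
      ≤ ENNReal.ofReal s := by
  refine iSup₂_le fun k hk => ?_
  rw [← Matrix.spectrum_toLin', ← Module.End.hasEigenvalue_iff_mem_spectrum] at hk
  obtain ⟨x, hx⟩ := hk.exists_hasEigenvector
  have hx0 := hx.2
  have hx1 := hx.apply_eq_smul
  rw [Matrix.toLin'_apply] at hx1
  set f : Matrix n n ℝ → Matrix n n ℂ := fun X => X.map (algebraMap ℝ ℂ) with hf
  have fm : ∀ X Y, f (X * Y) = f X * f Y := fun X Y => Matrix.map_mul
  have f1 : f 1 = 1 := by simp [hf]
  have hAd : IsUnit A.det := (Matrix.isUnit_iff_isUnit_det A).1 hA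
  have hEd : IsUnit E.det := (Matrix.isUnit_iff_isUnit_det E).1 hE
  have e1 : (A * E) * ((c • (A * E))⁻¹ * (c • (B * F))) = B * F := by
    have hu : IsUnit (c • (A * E)).det := by
      rw [Matrix.det_smul, Matrix.det_mul]
      exact ((isUnit_iff_ne_zero.2 hc).pow _).mul (hAd.mul hEd)
    have := Matrix.mul_nonsing_inv_cancel_left (c • (A * E)) (c • (B * F)) hu
    rw [Matrix.smul_mul] at this
    exact smul_right_injective _ hc this
  have e2 : f (B * F) *ᵥ x = k • (f (A * E) *ᵥ x) := by
    rw [← e1, fm, ← mulVec_mulVec, hx1, mulVec_smul]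
  set w := f (A⁻¹) *ᵥ (f F *ᵥ x) with hw
  have e3 : f A *ᵥ w = f F *ᵥ x := by
    rw [hw, mulVec_mulVec, ← fm, Matrix.mul_nonsing_inv _ hAd, f1, one_mulVec]
  have e4 : f B *ᵥ w = k • (f E *ᵥ x) := by
    have h1 : f A *ᵥ (f B *ᵥ w) = f A *ᵥ (k • (f E *ᵥ x)) := by
      rw [mulVec_mulVec, ← fm, hAB, fm, ← mulVec_mulVec, e3, mulVec_mulVec, ← fm, e2, fm,
        mulVec_smul, mulVec_mulVec]
    have h2 := congrArg (fun v => f (A⁻¹) *ᵥ v) h1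
    simpa only [mulVec_mulVec, ← fm, Matrix.nonsing_inv_mul_cancel_left _ _ hAd, mulVec_smul,
      ← Matrix.mul_assoc, Matrix.nonsing_inv_mul _ hAd, Matrix.one_mul] using h2
  set q : (n → ℂ) → ℝ := fun v => (star v ⬝ᵥ v).re with hq
  have qA : ∀ (X : Matrix n n ℝ) v, q (f X *ᵥ v) = (star v ⬝ᵥ (f (Xᵀ * X) *ᵥ v)).re := by
    intro X v
    simp only [hq, hf, aux_norm]
  have q0 : ∀ v, 0 ≤ q v := fun v => by
    simp only [hq, aux_re]
    exact Finset.sum_nonneg fun i _ => Complex.normSq_nonneg _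
  have qEF : q (f E *ᵥ x) = q (f F *ᵥ x) := by rw [qA, qA, hEF]
  have qC : s ^ 2 * q (f A *ᵥ w) = q (f B *ᵥ w) + q (f C *ᵥ w) := by
    have h1 : f (s ^ 2 • (Aᵀ * A)) = ((s ^ 2 : ℝ) : ℂ) • f (Aᵀ * A) := by
      ext i j; simp [hf]
    have h2 : f (Bᵀ * B + Cᵀ * C) = f (Bᵀ * B) + f (Cᵀ * C) := by
      ext i j; simp [hf]
    rw [qA, qA, qA, ← Complex.add_re, ← dotProduct_add, ← add_mulVec, ← h2, ← hC, h1, smul_mulVec,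
      dotProduct_smul, smul_eq_mul, Complex.re_ofReal_mul]
  have qk : q (k • (f E *ᵥ x)) = ‖k‖ ^ 2 * q (f E *ᵥ x) := by
    simp only [hq, aux_re, Finset.mul_sum, Pi.smul_apply, smul_eq_mul, Complex.normSq_mul,
      Complex.sq_norm]
  have qpos : 0 < q (f E *ᵥ x) := by
    refine lt_of_le_of_ne (q0 _) fun h => hx0 ?_
    simp only [hq, aux_re] at h
    have h3 : f E *ᵥ x = 0 := by
      funext i
      have := (Finset.sum_eq_zero_iff_of_nonneg fun i _ => Complex.normSq_nonneg _).1 h.symm i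
        (Finset.mem_univ i)
      simpa using this
    have h4 : f (E⁻¹) *ᵥ (f E *ᵥ x) = x := by
      rw [mulVec_mulVec, ← fm, Matrix.nonsing_inv_mul _ hEd, f1, one_mulVec]
    rw [← h4, h3, mulVec_zero]
  have hfin : ‖k‖ ^ 2 ≤ s ^ 2 := by
    rw [e4, qk, e3, ← qEF] at qC
    have := q0 (f C *ᵥ w)
    by_contra hcon
    push Not at hcon
    nlinarith [mul_lt_mul_of_pos_right hcon qpos]
  have hfin2 : ‖k‖ ≤ s := abs_le_of_sq_le_sq' hfin hs |>.2
  rw [← ENNReal.ofReal_coe_nnreal]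
  exact ENNReal.ofReal_le_ofReal hfin2

lemma aux_posdef {n : Type*} [Fintype n] [DecidableEq n] (A K : Matrix n n ℝ) (c : ℝ) (hc : 0 < c)
    (h : Aᵀ * A = c • (1 : Matrix n n ℝ) + Kᵀ * K) : IsUnit A := by
  have h1 : (c • (1 : Matrix n n ℝ) + Kᴴ * K).PosDef :=
    (Matrix.PosDef.one.smul hc).add_posSemidef (Matrix.posSemidef_conjTranspose_mul_self K)
  have h2 : IsUnit (Aᵀ * A) := by
    rw [h]; simpa using h1.isUnit
  rw [Matrix.isUnit_iff_isUnit_det, Matrix.det_mul] at h2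
  exact (Matrix.isUnit_iff_isUnit_det A).2 (isUnit_of_mul_isUnit_right h2)

lemma aux_psd {n : Type*} [Fintype n] [DecidableEq n] (T : Matrix n n ℝ) (hT : T.IsHermitian)
    (a b : ℝ) (h : ∀ μ ∈ spectrum ℝ T, 0 ≤ a - b * μ ^ 2) :
    ∃ C : Matrix n n ℝ, a • (1 : Matrix n n ℝ) - b • (T * T) = Cᵀ * C := by
  have hs := hT.spectral_theorem
  set U := hT.eigenvectorUnitary
  have h2 : a • (1 : Matrix n n ℝ) - b • (T * T)
      = Unitary.conjStarAlgAut ℝ _ U (diagonal fun i => a - b * hT.eigenvalues i ^ 2) := by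
    have : (diagonal fun i => a - b * hT.eigenvalues i ^ 2)
        = a • (1 : Matrix n n ℝ) - b • (diagonal (RCLike.ofReal ∘ hT.eigenvalues)
          * diagonal (RCLike.ofReal ∘ hT.eigenvalues)) := by
      ext i j
      by_cases hij : i = j
      · subst hij; simp [pow_two]
      · simp [hij]
    rw [this, map_sub, map_smul, map_smul, map_mul, map_one, ← hs]
  have h3 : (diagonal fun i => a - b * hT.eigenvalues i ^ 2)
      = (diagonal fun i => Real.sqrt (a - b * hT.eigenvalues i ^ 2))
        * (diagonal fun i => Real.sqrt (a - b * hT.eigenvalues i ^ 2)) := by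
    rw [diagonal_mul_diagonal]
    congr 1
    funext i
    exact (Real.mul_self_sqrt (h _ (hT.eigenvalues_mem_spectrum_real i))).symm
  refine ⟨(diagonal fun i => Real.sqrt (a - b * hT.eigenvalues i ^ 2)) *
    (U : Matrix n n ℝ)ᵀ, ?_⟩
  rw [h2, Unitary.conjStarAlgAut_apply, h3, transpose_mul, transpose_transpose,
    diagonal_transpose, star_eq_conjTranspose, conjTranspose_eq_transpose_of_trivial]
  simp only [Matrix.mul_assoc]

theorem stmt9 (M : ℕ) (T D : Matrix (Fin M) (Fin M) ℝ) (hT : T.PosDef) (hD : D.IsDiag)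
    (ω : ℝ) (hω : 0 < ω)
    (𝒯 𝒟 ℱ 𝒢 ℒ : Matrix (Fin M ⊕ Fin M) (Fin M ⊕ Fin M) ℝ)
    (h𝒯 : 𝒯 = fromBlocks 1 T (-T) 1) (h𝒟 : 𝒟 = fromBlocks 0 (-D) D 0)
    (hℱ : ℱ = (1 / (2 * ω)) • ((ω • 1 + 𝒯) * (ω • 1 + 𝒟)))
    (h𝒢 : 𝒢 = (1 / (2 * ω)) • ((ω • 1 - 𝒯) * (ω • 1 - 𝒟)))
    (hℒ : ℒ = ℱ⁻¹ * 𝒢) :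
    spectralRadius ℂ (ℒ.map (algebraMap ℝ ℂ))
      ≤ ENNReal.ofReal (⨆ μ ∈ spectrum ℝ T,
          Real.sqrt (((ω - 1) ^ 2 + μ ^ 2) / ((ω + 1) ^ 2 + μ ^ 2))) ∧
    (⨆ μ ∈ spectrum ℝ T, Real.sqrt (((ω - 1) ^ 2 + μ ^ 2) / ((ω + 1) ^ 2 + μ ^ 2))) < 1 := by
  set g : ℝ → ℝ := fun μ => Real.sqrt (((ω - 1) ^ 2 + μ ^ 2) / ((ω + 1) ^ 2 + μ ^ 2)) with hg
  have g0 : ∀ μ, 0 ≤ g μ := fun μ => Real.sqrt_nonneg _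
  have dpos : ∀ μ : ℝ, 0 < (ω + 1) ^ 2 + μ ^ 2 := fun μ => by positivity
  have g1 : ∀ μ, g μ < 1 := fun μ => by
    simp only [hg]
    rw [Real.sqrt_lt' one_pos, div_lt_iff₀ (dpos μ)]
    nlinarith
  have gsq : ∀ μ, g μ ^ 2 * ((ω + 1) ^ 2 + μ ^ 2) = (ω - 1) ^ 2 + μ ^ 2 := fun μ => by
    simp only [hg]
    rw [Real.sq_sqrt (by positivity), div_mul_cancel₀ _ (dpos μ).ne']
  have hfin : (spectrum ℝ T).Finite := Matrix.finite_real_spectrum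
  set G : ℝ → ℝ := fun μ => ⨆ (_ : μ ∈ spectrum ℝ T), g μ with hG
  have Gin : ∀ μ ∈ spectrum ℝ T, G μ = g μ := fun μ h => by simp [hG, h]
  have Gout : ∀ μ, μ ∉ spectrum ℝ T → G μ = 0 := fun μ h => by simp [hG, h]
  have hrange : (Set.range G).Finite := by
    refine ((hfin.image g).union (Set.finite_singleton 0)).subset ?_
    rintro _ ⟨μ, rfl⟩
    by_cases h : μ ∈ spectrum ℝ T
    · left; exact ⟨μ, h, (Gin μ h).symm⟩
    · right; exact Gout μ h
  have hmem : (⨆ μ, G μ) ∈ Set.range G := (Set.range_nonempty G).csSup_mem hrange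
  have hle : ∀ μ ∈ spectrum ℝ T, g μ ≤ ⨆ μ, G μ := fun μ h => by
    rw [← Gin μ h]; exact le_ciSup hrange.bddAbove μ
  change spectralRadius ℂ _ ≤ ENNReal.ofReal (⨆ μ, G μ) ∧ (⨆ μ, G μ) < 1
  set s := ⨆ μ, G μ with hsdef
  have hs : 0 ≤ s ∧ s < 1 := by
    obtain ⟨μ, hμ⟩ := hmem
    by_cases h : μ ∈ spectrum ℝ T
    · rw [← hμ, Gin μ h]; exact ⟨g0 μ, g1 μ⟩
    · rw [← hμ, Gout μ h]; norm_num
  refine ⟨?_, hs.2⟩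
  have hTt : Tᵀ = T := by simpa using hT.isHermitian.eq
  have hDt : Dᵀ = D := hD.isSymm
  obtain ⟨C, hC⟩ := aux_psd T hT.isHermitian (s ^ 2 * (ω + 1) ^ 2 - (ω - 1) ^ 2) (1 - s ^ 2) (by
    intro μ hμ
    have h1 : g μ ^ 2 ≤ s ^ 2 := pow_le_pow_left₀ (g0 μ) (hle μ hμ) 2
    nlinarith [mul_le_mul_of_nonneg_right h1 (dpos μ).le, gsq μ])
  have one_blk : (1 : Matrix (Fin M ⊕ Fin M) (Fin M ⊕ Fin M) ℝ) = fromBlocks 1 0 0 1 :=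
    fromBlocks_one.symm
  have hAA : (ω • 1 + 𝒯)ᵀ * (ω • 1 + 𝒯) = ((ω + 1) ^ 2) • 1 + fromBlocks (T * T) 0 0 (T * T) := by
    rw [h𝒯, one_blk]
    simp only [fromBlocks_smul, fromBlocks_add, fromBlocks_transpose, fromBlocks_multiply,
      transpose_add, transpose_smul, transpose_one, transpose_neg, transpose_zero, hTt]
    congr 1 <;> simp [add_mul, mul_add] <;> module
  have hBB : (ω • 1 - 𝒯)ᵀ * (ω • 1 - 𝒯) = ((ω - 1) ^ 2) • 1 + fromBlocks (T * T) 0 0 (T * T) := by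
    rw [h𝒯, one_blk, sub_eq_add_neg]
    simp only [fromBlocks_smul, fromBlocks_neg, fromBlocks_add, fromBlocks_transpose,
      fromBlocks_multiply,
      transpose_add, transpose_smul, transpose_one, transpose_neg, transpose_zero, hTt]
    congr 1 <;> simp [add_mul, mul_add] <;> module
  have hDD : 𝒟ᵀ = -𝒟 := by
    rw [h𝒟]; simp [fromBlocks_transpose, fromBlocks_neg, hDt]
  rw [hℒ, hℱ, h𝒢]
  refine aux_main _ _ _ _ (fromBlocks C 0 0 C) s hs.1 ?_ ?_ ?_ ?_ ?_ _ (by positivity)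
  · refine aux_posdef _ (fromBlocks T 0 0 T) ((ω + 1) ^ 2) (by positivity) ?_
    rw [hAA]; simp [fromBlocks_transpose, fromBlocks_multiply, hTt]
  · refine aux_posdef _ 𝒟 (ω ^ 2) (by positivity) ?_
    simp only [transpose_add, transpose_smul, transpose_one, hDD]
    simp [add_mul, mul_add]
    module
  · simp [add_mul, mul_add, sub_mul, mul_sub]
    try module
  · simp only [transpose_add, transpose_sub, transpose_smul, transpose_one, hDD]
    simp [add_mul, mul_add, sub_mul, mul_sub]
    try module
  · have hCC : (fromBlocks C 0 0 C)ᵀ * (fromBlocks C 0 0 C)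
        = fromBlocks (Cᵀ * C) 0 0 (Cᵀ * C) := by
      simp [fromBlocks_transpose, fromBlocks_multiply]
    rw [hAA, hBB, hCC, ← hC, one_blk]
    simp only [fromBlocks_smul, fromBlocks_add]
    congr 1 <;> simp [add_mul, mul_add] <;> module
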